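/- arXiv:2011.05931 — 2 statements merged into one kernel-verified Lean document; each statement's English description precedes it below -/
import Mathlib

section
/- Let n ≥ 1, d > 0 and λ, μ ∈ [0,∞)^n. Set a_i := log((λ_i + d)/(μ_i + d)) and b := ∑_{i=0}^{n−1} (λ_i − μ_i). Let Y = (Y_0, …, Y_{n−1}) be independent random variables with Y_i ~ Poisson(λ_i + d), and define D_i := E[ (Y_i/(λ_i + d) − 1) · 1{∑_{j=0}^{n−1} a_j Y_j < b} ] for each i ∈ {0, …, n−1}. Then for every i: D_i < 0 if and only if λ_i > μ_i; D_i = 0 if and only if λ_i = μ_i; and D_i > 0 if and only if λ_i < μ_i. -/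
open scoped BigOperators

/-- Poisson probability mass at `k` for mean `a`. -/
noncomputable def poissonPdf (a : ℝ) (k : ℕ) : ℝ :=
  Real.exp (-a) * a ^ k / (Nat.factorial k : ℝ)

/-- Joint pmf of independent Poisson coordinates with mean vector `m`. -/
noncomputable def prodPdf {n : ℕ} (m : Fin n → ℝ) (y : Fin n → ℕ) : ℝ :=
  ∏ i, poissonPdf (m i) (y i)

/-- Average error probability of a decoder `g` for the binary hypothesis test between
independent Poisson observations with mean vectors `lam + d` (hypothesis 1) and
`mu + d` (hypothesis 2); `g y = true` means "decide hypothesis 1". -/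
noncomputable def errProb {n : ℕ} (d : ℝ) (lam mu : Fin n → ℝ)
    (g : (Fin n → ℕ) → Bool) : ℝ :=
  (1/2) * (∑' y : Fin n → ℕ, if g y = false then prodPdf (fun i => lam i + d) y else 0)
  + (1/2) * (∑' y : Fin n → ℕ, if g y = true then prodPdf (fun i => mu i + d) y else 0)

/-- Minimal (maximum-likelihood) average error probability. -/
noncomputable def Pe {n : ℕ} (d : ℝ) (lam mu : Fin n → ℝ) : ℝ :=
  ⨅ g : (Fin n → ℕ) → Bool, errProb d lam mu g

/-- Convolution of a codeword `x` of length `N` with channel coefficients `p` of length `K`,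
giving the mean vector of length `N + K - 1`. -/
noncomputable def cconv {N K : ℕ} (x : Fin N → ℝ) (p : Fin K → ℝ) :
    Fin (N + K - 1) → ℝ :=
  fun i => ∑ j : Fin K,
    p j * (if h : (j : ℕ) ≤ (i : ℕ) ∧ (i : ℕ) - (j : ℕ) < N
      then x ⟨(i : ℕ) - (j : ℕ), h.2⟩ else 0)

/-- Sum of the `k` largest entries of `v`. -/
noncomputable def topSum {m : ℕ} (v : Fin m → ℝ) (k : ℕ) : ℝ :=
  ⨆ s ∈ {s : Finset (Fin m) | s.card = k}, ∑ i ∈ s, v i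

/-- Weak submajorization (from below): every top-`k` sum of `u` is at most that of `v`. -/
def weakSubmaj {m : ℕ} (u v : Fin m → ℝ) : Prop :=
  ∀ k, 1 ≤ k → k ≤ m → topSum u k ≤ topSum v k

theorem poissonPdf_pos {a : ℝ} (ha : 0 < a) (k : ℕ) : 0 < poissonPdf a k := by
  unfold poissonPdf
  positivity

theorem summable_poissonPdf (a : ℝ) : Summable (poissonPdf a) := by
  unfold poissonPdf
  simp_rw [mul_div_assoc]
  exact (Real.summable_pow_div_factorial a).mul_left _

theorem poissonPdf_succ_mul_div {a : ℝ} (ha : 0 < a) (k : ℕ) :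
    poissonPdf a (k + 1) * (((k + 1 : ℕ) : ℝ) / a) = poissonPdf a k := by
  unfold poissonPdf
  rw [Nat.factorial_succ, pow_succ]
  push_cast
  field_simp

theorem prodPdf_pos {n : ℕ} {m : Fin n → ℝ} (hm : ∀ i, 0 < m i) (y : Fin n → ℕ) :
    0 < prodPdf m y :=
  Finset.prod_pos fun i _ => poissonPdf_pos (hm i) _

theorem summable_prodPdf {n : ℕ} {m : Fin n → ℝ} (hm : ∀ i, 0 < m i) :
    Summable (prodPdf m) := by
  refine summable_of_sum_le (c := ∏ i, ∑' k, poissonPdf (m i) k)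
    (fun y => (prodPdf_pos hm y).le) fun s => ?_
  calc ∑ y ∈ s, prodPdf m y
      ≤ ∑ y ∈ Fintype.piFinset fun i => s.image fun y => y i, prodPdf m y := by
        refine Finset.sum_le_sum_of_subset_of_nonneg (fun y hy => ?_)
          fun y _ _ => (prodPdf_pos hm y).le
        exact Fintype.mem_piFinset.2 fun i => Finset.mem_image_of_mem _ hy
    _ = ∏ i, ∑ k ∈ s.image fun y => y i, poissonPdf (m i) k :=
        (Finset.prod_univ_sum _ _).symm
    _ ≤ ∏ i, ∑' k, poissonPdf (m i) k :=
        Finset.prod_le_prod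
          (fun i _ => Finset.sum_nonneg fun k _ => (poissonPdf_pos (hm i) k).le)
          fun i _ => (summable_poissonPdf (m i)).sum_le_tsum _
            fun k _ => (poissonPdf_pos (hm i) k).le

theorem prodPdf_add_single_mul_div {n : ℕ} {m : Fin n → ℝ} (hm : ∀ i, 0 < m i) (i : Fin n)
    (y : Fin n → ℕ) :
    prodPdf m (y + Pi.single i 1) * (((y + Pi.single i 1 : Fin n → ℕ) i : ℝ) / m i) = prodPdf m y := by
  unfold prodPdf
  rw [← Finset.mul_prod_erase _ _ (Finset.mem_univ i),
    ← Finset.mul_prod_erase _ (fun j => poissonPdf (m j) (y j)) (Finset.mem_univ i),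
    ← poissonPdf_succ_mul_div (hm i) (y i)]
  have h : ∏ j ∈ Finset.univ.erase i, poissonPdf (m j) ((y + Pi.single i 1 : Fin n → ℕ) j)
      = ∏ j ∈ Finset.univ.erase i, poissonPdf (m j) (y j) := by
    refine Finset.prod_congr rfl fun j hj => ?_
    simp [Pi.single_eq_of_ne (Finset.ne_of_mem_erase hj)]
  rw [h]
  simp only [Pi.add_apply, Pi.single_eq_same]
  ring

/-- The Stein-Chen identity for a bounded function of independent Poisson variables. -/
theorem tsum_prodPdf_mul_div_sub_one {n : ℕ} {m : Fin n → ℝ} (hm : ∀ i, 0 < m i) (i : Fin n)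
    {f : (Fin n → ℕ) → ℝ} {C : ℝ} (hf : ∀ y, |f y| ≤ C) :
    ∑' y, prodPdf m y * (((y i : ℝ) / m i - 1) * f y)
      = ∑' y, prodPdf m y * (f (y + Pi.single i 1) - f y) := by
  have hbd : ∀ g : (Fin n → ℕ) → ℝ, (∀ y, |g y| ≤ C) →
      Summable fun y => prodPdf m y * g y := fun g hg =>
    ((summable_prodPdf hm).mul_right C).of_norm_bounded fun y => by
      rw [Real.norm_eq_abs, abs_mul, abs_of_pos (prodPdf_pos hm y)]
      exact mul_le_mul_of_nonneg_left (hg y) (prodPdf_pos hm y).le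
  have hshift := hbd (fun y => f (y + Pi.single i 1)) fun y => hf _
  have hinj : Function.Injective fun y : Fin n → ℕ => y + Pi.single i 1 :=
    add_left_injective _
  set F : (Fin n → ℕ) → ℝ := fun y => prodPdf m y * ((y i : ℝ) / m i) * f y with hF
  have hcomp : (F ∘ fun y => y + Pi.single i 1)
      = fun y => prodPdf m y * f (y + Pi.single i 1) := by
    funext y
    simp only [hF, Function.comp_apply]
    rw [prodPdf_add_single_mul_div hm]
  have hsupp : ∀ y, y ∉ Set.range (fun y : Fin n → ℕ => y + Pi.single i 1) → F y = 0 := by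
    intro y hy
    have h0 : y i = 0 := by
      by_contra h
      refine hy ⟨y - Pi.single i 1, funext fun j => ?_⟩
      rcases eq_or_ne j i with rfl | hj
      · simp only [Pi.add_apply, Pi.sub_apply, Pi.single_eq_same]
        omega
      · simp [Pi.single_eq_of_ne hj]
    simp [hF, h0]
  have hFs : Summable F := by
    rw [← hinj.summable_iff hsupp, hcomp]
    exact hshift
  have hFt : ∑' y, F y = ∑' y, prodPdf m y * f (y + Pi.single i 1) := by
    rw [← hinj.tsum_eq (Function.support_subset_iff'.2 hsupp)]
    exact congrArg tsum hcomp
  calc ∑' y, prodPdf m y * (((y i : ℝ) / m i - 1) * f y)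
      = ∑' y, (F y - prodPdf m y * f y) := tsum_congr fun y => by simp only [hF]; ring
    _ = ∑' y, prodPdf m y * f (y + Pi.single i 1) - ∑' y, prodPdf m y * f y := by
        rw [hFs.tsum_sub (hbd f hf), hFt]
    _ = ∑' y, prodPdf m y * (f (y + Pi.single i 1) - f y) := by
        rw [← hshift.tsum_sub (hbd f hf)]
        exact tsum_congr fun y => by ring

theorem tsum_prodPdf_mul_pos {n : ℕ} {m : Fin n → ℝ} (hm : ∀ i, 0 < m i)
    {g : (Fin n → ℕ) → ℝ} {C : ℝ} (hC : ∀ y, g y ≤ C) (h0 : ∀ y, 0 ≤ g y)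
    {y : Fin n → ℕ} (hy : 0 < g y) : 0 < ∑' y, prodPdf m y * g y := by
  have hs : Summable fun y => prodPdf m y * g y :=
    ((summable_prodPdf hm).mul_right C).of_nonneg_of_le
      (fun y => mul_nonneg (prodPdf_pos hm y).le (h0 y))
      fun y => mul_le_mul_of_nonneg_left (hC y) (prodPdf_pos hm y).le
  exact hs.tsum_pos (fun y => mul_nonneg (prodPdf_pos hm y).le (h0 y)) y
    (mul_pos (prodPdf_pos hm y) hy)

theorem sum_mul_add_single {n : ℕ} (a : Fin n → ℝ) (y : Fin n → ℕ) (i : Fin n) (k : ℕ) :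
    ∑ j, a j * (((y + Pi.single i k : Fin n → ℕ) j : ℕ) : ℝ) = ∑ j, a j * (y j : ℝ) + a i * k := by
  simp only [Pi.add_apply, Nat.cast_add, mul_add, Finset.sum_add_distrib, add_right_inj]
  rw [Finset.sum_eq_single i]
  · simp
  · intro j _ hj
    simp [Pi.single_eq_of_ne hj]
  · simp

theorem exists_sum_mul_lt {n : ℕ} {a : Fin n → ℝ} {j : Fin n} (hj : a j < 0) (b : ℝ)
    (y : Fin n → ℕ) :
    ∃ k : ℕ, ∑ l, a l * (((y + Pi.single j k : Fin n → ℕ) l : ℕ) : ℝ) < b := by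
  obtain ⟨k, hk⟩ := exists_nat_gt ((b - ∑ l, a l * (y l : ℝ)) / a j)
  refine ⟨k, ?_⟩
  rw [sum_mul_add_single]
  rw [div_lt_iff_of_neg hj] at hk
  linarith

theorem exists_le_sum_mul {n : ℕ} {a : Fin n → ℝ} {j : Fin n} (hj : 0 < a j) (b : ℝ)
    (y : Fin n → ℕ) :
    ∃ k : ℕ, b ≤ ∑ l, a l * (((y + Pi.single j k : Fin n → ℕ) l : ℕ) : ℝ) := by
  obtain ⟨k, hk⟩ := exists_nat_gt ((b - ∑ l, a l * (y l : ℝ)) / a j)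
  refine ⟨k, ?_⟩
  rw [sum_mul_add_single]
  rw [div_lt_iff₀ hj] at hk
  linarith

theorem exists_not_and_add_single {n : ℕ} {P : (Fin n → ℕ) → Prop} {i : Fin n} {y : Fin n → ℕ}
    (hy : ¬ P y) (h : ∃ k : ℕ, P (y + Pi.single i k)) :
    ∃ z, ¬ P z ∧ P (z + Pi.single i 1) := by
  by_contra! hP
  obtain ⟨k, hk⟩ := h
  refine (?_ : ∀ k, ¬ P (y + Pi.single i k)) k hk
  intro k
  induction k with
  | zero => simpa using hy
  | succ k ih =>
    rw [Pi.single_add, ← add_assoc]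
    exact hP _ ih

/-- Sign of the first-derivative coefficients: with `a_i = log((λ_i+d)/(μ_i+d))`,
`b = ∑ (λ_i − μ_i)`, and `D_i = E[(Y_i/(λ_i+d) − 1)·1{∑ a_j Y_j < b}]` for independent
`Y_i ~ Poisson(λ_i + d)`, one has `D_i < 0 ↔ λ_i > μ_i`, `D_i = 0 ↔ λ_i = μ_i`, and
`D_i > 0 ↔ λ_i < μ_i`. -/
theorem stmt11 (n : ℕ) (hn : 1 ≤ n) (d : ℝ) (hd : 0 < d)
    (lam mu : Fin n → ℝ) (hlam : ∀ i, 0 ≤ lam i) (hmu : ∀ i, 0 ≤ mu i)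
    (a : Fin n → ℝ) (ha : ∀ i, a i = Real.log ((lam i + d) / (mu i + d)))
    (b : ℝ) (hb : b = ∑ i, (lam i - mu i))
    (D : Fin n → ℝ)
    (hD : ∀ i, D i = ∑' y : Fin n → ℕ,
        prodPdf (fun j => lam j + d) y *
          (((y i : ℝ) / (lam i + d) - 1) *
            (if (∑ j, a j * (y j : ℝ)) < b then 1 else 0))) :
    ∀ i, (D i < 0 ↔ mu i < lam i) ∧ (D i = 0 ↔ lam i = mu i) ∧ (0 < D i ↔ lam i < mu i) := by
  have hl : ∀ i, 0 < lam i + d := fun i => add_pos_of_nonneg_of_pos (hlam i) hd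
  have hm : ∀ i, 0 < mu i + d := fun i => add_pos_of_nonneg_of_pos (hmu i) hd
  have a_pos : ∀ i, mu i < lam i → 0 < a i := fun i h => by
    rw [ha]
    exact Real.log_pos ((one_lt_div (hm i)).2 (by linarith))
  have a_neg : ∀ i, lam i < mu i → a i < 0 := fun i h => by
    rw [ha]
    exact Real.log_neg (div_pos (hl i) (hm i)) ((div_lt_one (hm i)).2 (by linarith))
  have a_zero : ∀ i, lam i = mu i → a i = 0 := fun i h => by
    rw [ha, h, div_self (hm i).ne', Real.log_one]
  intro i
  set f : (Fin n → ℕ) → ℝ := fun y => if (∑ j, a j * (y j : ℝ)) < b then 1 else 0 with hf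
  have hDi : D i = ∑' y, prodPdf (fun j => lam j + d) y * (f (y + Pi.single i 1) - f y) := by
    rw [hD]
    refine tsum_prodPdf_mul_div_sub_one (m := fun j => lam j + d) hl i (f := f) (C := 1) fun y => ?_
    simp only [hf]
    split_ifs <;> simp
  have hstep : ∀ y : Fin n → ℕ,
      f (y + Pi.single i 1) = if (∑ j, a j * (y j : ℝ)) + a i < b then 1 else 0 := by
    intro y
    simp only [hf]
    rw [sum_mul_add_single, Nat.cast_one, mul_one]
  have hneg : mu i < lam i → D i < 0 := by
    intro h
    have hai := a_pos i h
    have hlow : ∃ y : Fin n → ℕ, ∑ j, a j * (y j : ℝ) < b := by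
      by_cases hb0 : 0 < b
      · exact ⟨0, by simpa using hb0⟩
      · obtain ⟨j, hj⟩ : ∃ j, lam j < mu j := by
          by_contra! hall
          exact hb0 (hb ▸ Finset.sum_pos' (fun j _ => sub_nonneg.2 (hall j))
            ⟨i, Finset.mem_univ i, sub_pos.2 h⟩)
        obtain ⟨k, hk⟩ := exists_sum_mul_lt (a_neg j hj) b 0
        exact ⟨_, hk⟩
    obtain ⟨y, hy⟩ := hlow
    obtain ⟨z, hz, hz'⟩ := exists_not_and_add_single
      (P := fun y => b ≤ ∑ j, a j * (y j : ℝ)) (not_le.2 hy) (exists_le_sum_mul hai b y)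
    have hpos : 0 < ∑' y, prodPdf (fun j => lam j + d) y * (f y - f (y + Pi.single i 1)) := by
      refine tsum_prodPdf_mul_pos hl (C := 1) (fun y => ?_) (fun y => ?_) (y := z) ?_
      · simp only [hf]
        split_ifs <;> simp
      · rw [hstep]
        simp only [hf]
        split_ifs <;> linarith
      · simp only [hf]
        rw [if_pos (not_le.1 hz), if_neg (not_lt.2 hz')]
        norm_num
    rw [hDi, ← neg_pos, ← tsum_neg]
    simpa only [← mul_neg, neg_sub] using hpos
  have hpos : lam i < mu i → 0 < D i := by
    intro h
    have hai := a_neg i h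
    have hhigh : ∃ y : Fin n → ℕ, b ≤ ∑ j, a j * (y j : ℝ) := by
      by_cases hb0 : b ≤ 0
      · exact ⟨0, by simpa using hb0⟩
      · obtain ⟨j, hj⟩ : ∃ j, mu j < lam j := by
          by_contra! hall
          exact hb0 (hb ▸ Finset.sum_nonpos fun j _ => sub_nonpos.2 (hall j))
        obtain ⟨k, hk⟩ := exists_le_sum_mul (a_pos j hj) b 0
        exact ⟨_, hk⟩
    obtain ⟨y, hy⟩ := hhigh
    obtain ⟨z, hz, hz'⟩ := exists_not_and_add_single
      (P := fun y => ∑ j, a j * (y j : ℝ) < b) (not_lt.2 hy) (exists_sum_mul_lt hai b y)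
    rw [hDi]
    refine tsum_prodPdf_mul_pos hl (C := 1) (fun y => ?_) (fun y => ?_) (y := z) ?_
    · simp only [hf]
      split_ifs <;> simp
    · rw [hstep]
      simp only [hf]
      split_ifs <;> linarith
    · simp only [hf]
      rw [if_neg hz, if_pos hz']
      norm_num
  have hzero : lam i = mu i → D i = 0 := by
    intro h
    simp only [hDi, hstep, a_zero i h, add_zero]
    simp only [hf, sub_self, mul_zero, tsum_zero]
  rcases lt_trichotomy (lam i) (mu i) with h | h | h
  · have := hpos h
    exact ⟨iff_of_false this.not_gt h.not_gt, iff_of_false this.ne' h.ne, iff_of_true this h⟩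
  · have := hzero h
    simp [this, h]
  · have := hneg h
    exact ⟨iff_of_true this h, iff_of_false this.ne h.ne', iff_of_false this.not_gt h.not_gt⟩
end

section
/- Let N ≥ 1, d > 0 and A ≥ 2d. Let λ = (A, A, …, A) ∈ [0,∞)^N and μ = (0, 0, …, 0) ∈ [0,∞)^N. Then (1/2)·e^{−N(A+d)} ≤ P_e(λ, μ) ≤ e^{−N(A+d)} · ( e·(A+d)·log((A+d)/d) / A )^{N·A / log((A+d)/d)}. -/
open scoped BigOperators

theorem hasSum_prod_pi_of_nonneg {α : Type*} {n : ℕ} {f : Fin n → α → ℝ} {a : Fin n → ℝ}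
    (hf : ∀ i, HasSum (f i) (a i)) (h0 : ∀ i k, 0 ≤ f i k) :
    HasSum (fun y : Fin n → α => ∏ i, f i (y i)) (∏ i, a i) := by
  induction n with
  | zero => simp
  | succ n ih =>
    have ht := ih (fun i => hf i.succ) (fun i => h0 i.succ)
    have hmul := (hf 0).summable.mul_of_nonneg ht.summable (h0 0)
      (fun y => Finset.prod_nonneg fun i _ => h0 i.succ (y i))
    have hs := (hf 0).mul ht hmul
    rw [← (Fin.consEquiv (fun _ : Fin (n + 1) => α)).hasSum_iff]
    simpa [Fin.prod_univ_succ, Function.comp_def, Fin.consEquiv] using hs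

theorem hasSum_poissonPdf (a : ℝ) : HasSum (poissonPdf a) 1 := by
  have h := (NormedSpace.expSeries_div_hasSum_exp a).mul_left (Real.exp (-a))
  rw [← Real.exp_eq_exp_ℝ, ← Real.exp_add, neg_add_cancel, Real.exp_zero] at h
  exact h.congr_fun fun k => by rw [poissonPdf, mul_div_assoc]

theorem poissonPdf_nonneg {a : ℝ} (ha : 0 ≤ a) (k : ℕ) : 0 ≤ poissonPdf a k := by
  unfold poissonPdf
  positivity

theorem prodPdf_nonneg {n : ℕ} {m : Fin n → ℝ} (hm : ∀ i, 0 ≤ m i) (y : Fin n → ℕ) :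
    0 ≤ prodPdf m y :=
  Finset.prod_nonneg fun i _ => poissonPdf_nonneg (hm i) (y i)

theorem hasSum_prodPdf {n : ℕ} {m : Fin n → ℝ} (hm : ∀ i, 0 ≤ m i) :
    HasSum (prodPdf m) 1 := by
  have h := hasSum_prod_pi_of_nonneg (fun i => hasSum_poissonPdf (m i))
    (fun i => poissonPdf_nonneg (hm i))
  rwa [Finset.prod_const_one] at h

theorem ite_prodPdf_nonneg {n : ℕ} {m : Fin n → ℝ} (hm : ∀ i, 0 ≤ m i)
    (p : (Fin n → ℕ) → Prop) [DecidablePred p] (y : Fin n → ℕ) :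
    0 ≤ if p y then prodPdf m y else 0 :=
  ite_nonneg (prodPdf_nonneg hm y) le_rfl

theorem summable_ite_prodPdf {n : ℕ} {m : Fin n → ℝ} (hm : ∀ i, 0 ≤ m i)
    (p : (Fin n → ℕ) → Prop) [DecidablePred p] :
    Summable fun y => if p y then prodPdf m y else 0 := by
  refine (hasSum_prodPdf hm).summable.of_nonneg_of_le (ite_prodPdf_nonneg hm p) fun y => ?_
  split_ifs
  exacts [le_rfl, prodPdf_nonneg hm y]

theorem prodPdf_const {n : ℕ} (a : ℝ) (y : Fin n → ℕ) :
    prodPdf (fun _ => a) y =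
      Real.exp (-(n * a)) * a ^ (∑ i, y i) / ∏ i, (Nat.factorial (y i) : ℝ) := by
  simp only [prodPdf, poissonPdf, Finset.prod_div_distrib, Finset.prod_mul_distrib,
    Finset.prod_const, Finset.card_univ, Fintype.card_fin, Finset.prod_pow_eq_pow_sum,
    ← Real.exp_nat_mul, mul_neg]

theorem prodPdf_zero {n : ℕ} (m : Fin n → ℝ) :
    prodPdf m 0 = Real.exp (-∑ i, m i) := by
  simp [prodPdf, poissonPdf, ← Real.exp_sum]

theorem errProb_nonneg {n : ℕ} {d : ℝ} {lam mu : Fin n → ℝ} (hl : ∀ i, 0 ≤ lam i + d)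
    (hm : ∀ i, 0 ≤ mu i + d) (g : (Fin n → ℕ) → Bool) : 0 ≤ errProb d lam mu g := by
  unfold errProb
  have h₁ := tsum_nonneg (L := .unconditional _) (ite_prodPdf_nonneg hl fun z => g z = false)
  have h₂ := tsum_nonneg (L := .unconditional _) (ite_prodPdf_nonneg hm fun z => g z = true)
  positivity

/-- Every single observation `y` contributes the smaller of its two likelihoods to the error. -/
theorem half_min_prodPdf_le_Pe {n : ℕ} {d : ℝ} {lam mu : Fin n → ℝ} (hl : ∀ i, 0 ≤ lam i + d)
    (hm : ∀ i, 0 ≤ mu i + d) (y : Fin n → ℕ) :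
    (1/2) * min (prodPdf (fun i => lam i + d) y) (prodPdf (fun i => mu i + d) y)
      ≤ Pe d lam mu := by
  refine le_ciInf fun g => ?_
  have nonneg₁ := ite_prodPdf_nonneg hl fun z => g z = false
  have nonneg₂ := ite_prodPdf_nonneg hm fun z => g z = true
  have h₁ := (summable_ite_prodPdf hl fun z => g z = false).le_tsum y fun z _ => nonneg₁ z
  have h₂ := (summable_ite_prodPdf hm fun z => g z = true).le_tsum y fun z _ => nonneg₂ z
  have hmin₁ := min_le_left (prodPdf (fun i => lam i + d) y) (prodPdf (fun i => mu i + d) y)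
  have hmin₂ := min_le_right (prodPdf (fun i => lam i + d) y) (prodPdf (fun i => mu i + d) y)
  unfold errProb
  cases hg : g y
  · have h := tsum_nonneg (L := .unconditional _) nonneg₂
    simp only [hg, if_true] at h₁
    linarith
  · have h := tsum_nonneg (L := .unconditional _) nonneg₁
    simp only [hg, if_true] at h₂
    linarith

/-- If every likelihood that a decoder sacrifices is dominated by `C` times a fixed product
Poisson law, then `C / 2` bounds the error probability. -/
theorem Pe_le_of_dominated {n : ℕ} {d C : ℝ} {lam mu m : Fin n → ℝ}
    (hl : ∀ i, 0 ≤ lam i + d) (hm : ∀ i, 0 ≤ mu i + d) (h0 : ∀ i, 0 ≤ m i)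
    (g : (Fin n → ℕ) → Bool)
    (h₁ : ∀ y, g y = false → prodPdf (fun i => lam i + d) y ≤ C * prodPdf m y)
    (h₂ : ∀ y, g y = true → prodPdf (fun i => mu i + d) y ≤ C * prodPdf m y) :
    Pe d lam mu ≤ (1/2) * C := by
  have hbdd : BddBelow (Set.range (errProb d lam mu)) :=
    ⟨0, by rintro _ ⟨g, rfl⟩; exact errProb_nonneg hl hm g⟩
  refine (ciInf_le hbdd g).trans ?_
  have s₁ := summable_ite_prodPdf hl (fun z => g z = false)
  have s₂ := summable_ite_prodPdf hm (fun z => g z = true)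
  have hle := hasSum_le (fun y => by
    cases hg : g y
    · simpa [hg] using h₁ y hg
    · simpa [hg] using h₂ y hg) (s₁.hasSum.add s₂.hasSum) ((hasSum_prodPdf h0).mul_left C)
  unfold errProb
  linarith

theorem prodPdf_const_le_of_pow_le {n : ℕ} {a m T : ℝ} (hm : 0 < m)
    (y : Fin n → ℕ) (h : (a / m) ^ (∑ i, y i) ≤ (a / m) ^ T) :
    prodPdf (fun _ => a) y ≤
      Real.exp (n * m - n * a) * (a / m) ^ T * prodPdf (fun _ => m) y := by
  have hexp : Real.exp (n * m - n * a) * Real.exp (-(n * m)) = Real.exp (-(n * a)) := by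
    rw [← Real.exp_add]; ring_nf
  have hfac : 0 < ∏ i, (Nat.factorial (y i) : ℝ) :=
    Finset.prod_pos fun i _ => by positivity
  rw [prodPdf_const, prodPdf_const]
  calc Real.exp (-(n * a)) * a ^ (∑ i, y i) / ∏ i, (Nat.factorial (y i) : ℝ)
      = Real.exp (-(n * a)) * ((a / m) ^ (∑ i, y i) * m ^ (∑ i, y i)) /
          ∏ i, (Nat.factorial (y i) : ℝ) := by
        rw [← mul_pow, div_mul_cancel₀ a hm.ne']
    _ ≤ Real.exp (-(n * a)) * ((a / m) ^ T * m ^ (∑ i, y i)) /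
          ∏ i, (Nat.factorial (y i) : ℝ) := by gcongr
    _ = _ := by rw [← hexp]; ring

/-- The log-mean `A / log ((A + d) / d)` of `d` and `A + d` lies between them. -/
theorem logMean_mem_Icc {d A : ℝ} (hd : 0 < d) (hA : 0 < A) :
    A / Real.log ((A + d) / d) ∈ Set.Icc d (A + d) := by
  have hr : 1 < (A + d) / d := by rw [one_lt_div hd]; linarith
  have hL : 0 < Real.log ((A + d) / d) := Real.log_pos hr
  constructor
  · rw [le_div_iff₀ hL]
    have h := mul_le_mul_of_nonneg_left (Real.log_le_sub_one_of_pos (zero_lt_one.trans hr)) hd.le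
    rwa [mul_sub, mul_div_cancel₀ _ hd.ne', mul_one, add_sub_cancel_right] at h
  · rw [div_le_iff₀ hL]
    have h := mul_le_mul_of_nonneg_left (Real.one_sub_inv_le_log_of_pos (zero_lt_one.trans hr))
      (by linarith : 0 ≤ A + d)
    have e : (A + d) * (1 - ((A + d) / d)⁻¹) = A := by
      have : A + d ≠ 0 := by positivity
      field_simp
      ring
    rwa [e] at h

/-- Bounds on the ML error probability of the on/off code `λ = (A,…,A)`, `μ = (0,…,0)`
for `A ≥ 2d`. -/
theorem stmt13 (N : ℕ) (hN : 1 ≤ N) (d A : ℝ) (hd : 0 < d) (hA : 2 * d ≤ A) :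
    (1/2) * Real.exp (-((N : ℝ) * (A + d)))
        ≤ Pe d (fun _ : Fin N => A) (fun _ : Fin N => (0 : ℝ)) ∧
    Pe d (fun _ : Fin N => A) (fun _ : Fin N => (0 : ℝ))
        ≤ Real.exp (-((N : ℝ) * (A + d))) *
          (Real.exp 1 * (A + d) * Real.log ((A + d) / d) / A)
            ^ (((N : ℝ) * A) / Real.log ((A + d) / d)) := by
  have hA0 : 0 < A := by linarith
  have hAd : 0 < A + d := by linarith
  constructor
  · refine le_trans ?_ (half_min_prodPdf_le_Pe (fun _ => hAd.le) (fun _ => by linarith) 0)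
    have hle : (N : ℝ) * d ≤ N * (A + d) := by gcongr; linarith
    simpa [prodPdf_zero, ← mul_add] using hle
  set L := Real.log ((A + d) / d) with hLdef
  have hL : 0 < L := Real.log_pos (by rw [one_lt_div hd]; linarith)
  set m := A / L with hmdef
  obtain ⟨hdm, hmA⟩ : m ∈ Set.Icc d (A + d) := logMean_mem_Icc hd hA0
  have hm : 0 < m := hd.trans_le hdm
  have hC : Real.exp (-((N : ℝ) * (A + d))) *
      (Real.exp 1 * (A + d) * L / A) ^ ((N : ℝ) * A / L) =
      Real.exp (N * m - N * (A + d)) * ((A + d) / m) ^ (N * m) := by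
    have hbase : Real.exp 1 * (A + d) * L / A = Real.exp 1 * ((A + d) / m) := by
      rw [hmdef]; field_simp
    rw [hbase, mul_div_assoc, ← hmdef, Real.mul_rpow (Real.exp_pos _).le (by positivity),
      ← Real.exp_mul, one_mul, ← mul_assoc, ← Real.exp_add]
    ring_nf
  have hC' : Real.exp (N * m - N * (A + d)) * ((A + d) / m) ^ (N * m) =
      Real.exp (N * m - N * d) * (d / m) ^ (N * m) := by
    have hsplit : (A + d) / m = (A + d) / d * (d / m) := by field_simp
    have hLm : L * (N * m) = N * A := by rw [hmdef]; field_simp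
    rw [hsplit, Real.mul_rpow (by positivity) (by positivity),
      Real.rpow_def_of_pos (by positivity : 0 < (A + d) / d), ← hLdef, hLm, ← mul_assoc,
      ← Real.exp_add]
    ring_nf
  rw [hC]
  have hC0 : 0 ≤ Real.exp (N * m - N * (A + d)) * ((A + d) / m) ^ (N * m) := by positivity
  refine (Pe_le_of_dominated
    (C := Real.exp (N * m - N * (A + d)) * ((A + d) / m) ^ (N * m)) (fun _ => hAd.le) (fun _ => by linarith) (fun _ => hm.le)
    (fun y => decide ((N : ℝ) * m < (∑ i, y i : ℕ))) (fun y hy => ?_) (fun y hy => ?_)).trans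
    (by linarith)
  · have hy' : ((∑ i, y i : ℕ) : ℝ) ≤ N * m := by simpa using hy
    refine prodPdf_const_le_of_pow_le hm y ?_
    rw [← Real.rpow_natCast]
    exact Real.rpow_le_rpow_of_exponent_le ((one_le_div hm).2 hmA) hy'
  · have hy' : (N : ℝ) * m < (∑ i, y i : ℕ) := by simpa using hy
    rw [hC']
    simp only [zero_add]
    refine prodPdf_const_le_of_pow_le hm y ?_
    rw [← Real.rpow_natCast]
    exact Real.rpow_le_rpow_of_exponent_ge (by positivity) ((div_le_one hm).2 hdm) hy'.le
end
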